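/- arXiv:1302.4063 — 2 statements merged into one kernel-verified Lean document; each statement's English description precedes it below -/
import Mathlib

section
/- For every integer n ≥ 3, in the set S_n(132,231): f_{123}(S_n(132,231)) = f_{213}(S_n(132,231)) = f_{312}(S_n(132,231)) = f_{321}(S_n(132,231)) = binom(n,3)·2^{n−3}. -/
open Finset

/-- Number of occurrences of the length-3 pattern `q` (given by its sequence of values)
in the permutation `σ` of `Fin n`: triples of indices `ι 0 < ι 1 < ι 2` whose values under
`σ` are in the same relative order as the values of `q`. -/
def occ (n : ℕ) (q : Fin 3 → ℕ) (σ : Equiv.Perm (Fin n)) : ℕ :=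
  (Finset.univ.filter fun ι : Fin 3 → Fin n =>
    (∀ j l : Fin 3, j < l → ι j < ι l) ∧
    (∀ j l : Fin 3, q j < q l ↔ σ (ι j) < σ (ι l))).card

/-- The set `S_n(R)` of permutations of `{1,…,n}` avoiding every pattern in `R`. -/
def avoiders (n : ℕ) (R : List (Fin 3 → ℕ)) : Finset (Equiv.Perm (Fin n)) :=
  Finset.univ.filter fun σ => ∀ q ∈ R, occ n q σ = 0

/-- `f_q(S_n(R))`: the total number of occurrences of the pattern `q` among
all permutations in `S_n(R)`. -/
def fCnt (n : ℕ) (q : Fin 3 → ℕ) (R : List (Fin 3 → ℕ)) : ℕ :=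
  ∑ σ ∈ avoiders n R, occ n q σ

def p123 : Fin 3 → ℕ := ![1, 2, 3]
def p132 : Fin 3 → ℕ := ![1, 3, 2]
def p213 : Fin 3 → ℕ := ![2, 1, 3]
def p231 : Fin 3 → ℕ := ![2, 3, 1]
def p312 : Fin 3 → ℕ := ![3, 1, 2]
def p321 : Fin 3 → ℕ := ![3, 2, 1]

/-- The sort key of a value: the values in `S` are negated, so that sorting by the key puts
them in decreasing order in front of the remaining values, which appear in increasing order. -/
def sideKey {n : ℕ} (S : Finset (Fin n)) (v : Fin n) : ℤ :=
  if v ∈ S then -(v : ℤ) else v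

theorem sideKey_injective {n : ℕ} (S : Finset (Fin n)) : Function.Injective (sideKey S) := by
  intro a b h
  unfold sideKey at h
  split_ifs at h <;> ext <;> omega

theorem strictMono_sideKey_comp_sort {n : ℕ} (S : Finset (Fin n)) :
    StrictMono (sideKey S ∘ Tuple.sort (sideKey S)) :=
  (Tuple.monotone_sort _).strictMono_of_injective
    ((sideKey_injective S).comp (Tuple.sort _).injective)

theorem sort_symm_lt_iff {n : ℕ} (S : Finset (Fin n)) (u v : Fin n) :
    (Tuple.sort (sideKey S)).symm u < (Tuple.sort (sideKey S)).symm v ↔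
      sideKey S u < sideKey S v := by
  simpa using ((strictMono_sideKey_comp_sort S).lt_iff_lt
    (a := (Tuple.sort (sideKey S)).symm u) (b := (Tuple.sort (sideKey S)).symm v)).symm

theorem eq_sort_sideKey {n : ℕ} {S : Finset (Fin n)} {σ : Equiv.Perm (Fin n)}
    (h : StrictMono (sideKey S ∘ σ)) : Tuple.sort (sideKey S) = σ := by
  have := Tuple.unique_monotone (f := sideKey S) (Tuple.monotone_sort _) h.monotone
  ext i
  exact congrArg Fin.val (sideKey_injective S (congrFun this i))

theorem occ_p132_eq_zero_iff {n : ℕ} {σ : Equiv.Perm (Fin n)} :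
    occ n p132 σ = 0 ↔ ∀ i j k, i < j → j < k → σ i < σ k → ¬ σ k < σ j := by
  simp only [occ, card_eq_zero, filter_eq_empty_iff, mem_univ, true_implies]
  constructor
  · intro h i j k hij hjk hik hkj
    apply @h ![i, j, k]
    simp [Fin.forall_fin_succ, p132]
    lia
  · intro h ι hι
    simp [Fin.forall_fin_succ, p132] at hι
    exact h (ι 0) (ι 1) (ι 2) (by lia) (by lia) (by lia) (by lia)

theorem occ_p231_eq_zero_iff {n : ℕ} {σ : Equiv.Perm (Fin n)} :
    occ n p231 σ = 0 ↔ ∀ i j k, i < j → j < k → σ k < σ i → ¬ σ i < σ j := by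
  simp only [occ, card_eq_zero, filter_eq_empty_iff, mem_univ, true_implies]
  constructor
  · intro h i j k hij hjk hik hkj
    apply @h ![i, j, k]
    simp [Fin.forall_fin_succ, p231]
    lia
  · intro h ι hι
    simp [Fin.forall_fin_succ, p231] at hι
    exact h (ι 0) (ι 1) (ι 2) (by lia) (by lia) (by lia) (by lia)

theorem mem_avoiders_iff {n : ℕ} {σ : Equiv.Perm (Fin n)} :
    σ ∈ avoiders n [p132, p231] ↔
      ∀ i j k, i < j → j < k → σ i < σ j → σ j < σ k := by
  simp only [avoiders, mem_filter, mem_univ, true_and, List.mem_cons, List.not_mem_nil, or_false,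
    forall_eq_or_imp, forall_eq, occ_p132_eq_zero_iff, occ_p231_eq_zero_iff]
  constructor
  · rintro ⟨h1, h2⟩ i j k hij hjk h
    have hne : σ i ≠ σ k := σ.injective.ne (by lia)
    have hne' : σ j ≠ σ k := σ.injective.ne (by lia)
    by_contra hc
    rcases lt_or_gt_of_ne hne with h' | h'
    · exact h1 i j k hij hjk h' (by lia)
    · exact h2 i j k hij hjk h' h
  · intro h
    refine ⟨fun i j k hij hjk h1 h2 => ?_, fun i j k hij hjk h1 h2 => ?_⟩
    · have := h i j k hij hjk (by lia)
      lia
    · have := h i j k hij hjk h2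
      lia

theorem sort_sideKey_mem_avoiders {n : ℕ} (S : Finset (Fin n)) :
    Tuple.sort (sideKey S) ∈ avoiders n [p132, p231] := by
  rw [mem_avoiders_iff]
  intro i j k hij hjk h
  have h1 := strictMono_sideKey_comp_sort S hij
  have h2 := strictMono_sideKey_comp_sort S hjk
  simp only [Function.comp_apply, sideKey] at h1 h2
  rw [Fin.lt_def] at h ⊢
  split_ifs at h1 h2 <;> omega

/-- The values standing to the left of the value `0`. -/
def leftValues {m : ℕ} (σ : Equiv.Perm (Fin (m + 1))) : Finset (Fin (m + 1)) :=
  univ.filter fun v => σ.symm v < σ.symm 0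

theorem leftValues_subset {m : ℕ} (σ : Equiv.Perm (Fin (m + 1))) :
    leftValues σ ⊆ univ.erase 0 := by
  intro v hv
  simp only [leftValues, mem_filter] at hv
  simp only [mem_erase, mem_univ, and_true]
  rintro rfl
  exact lt_irrefl _ hv.2

theorem leftValues_sort_sideKey {m : ℕ} {S : Finset (Fin (m + 1))} (hS : S ⊆ univ.erase 0) :
    leftValues (Tuple.sort (sideKey S)) = S := by
  ext v
  have h0 : (0 : Fin (m + 1)) ∉ S := fun h => by simpa using hS h
  simp only [leftValues, mem_filter, mem_univ, true_and, sort_symm_lt_iff]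
  simp only [sideKey, if_neg h0, Fin.val_zero]
  constructor
  · intro h
    by_contra hv
    rw [if_neg hv] at h
    omega
  · intro hv
    have : 0 < v.val := Fin.pos_iff_ne_zero.2 fun h => h0 (h ▸ hv)
    rw [if_pos hv]
    omega

theorem sort_sideKey_leftValues {m : ℕ} {σ : Equiv.Perm (Fin (m + 1))}
    (hσ : σ ∈ avoiders (m + 1) [p132, p231]) :
    Tuple.sort (sideKey (leftValues σ)) = σ := by
  rw [mem_avoiders_iff] at hσ
  apply eq_sort_sideKey
  intro i j hij
  obtain ⟨z, hz⟩ : ∃ z, σ z = 0 := ⟨σ.symm 0, by simp⟩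
  have hz' : σ.symm 0 = z := by simp [← hz]
  have hmin : ∀ k, k ≠ z → 0 < (σ k).val := fun k hk => by
    have : σ k ≠ σ z := σ.injective.ne hk
    rw [hz] at this
    exact Fin.pos_iff_ne_zero.mpr this
  simp only [Function.comp_apply, sideKey, leftValues, mem_filter, mem_univ, true_and,
    Equiv.symm_apply_apply, hz']
  have hne := Fin.val_ne_of_ne (σ.injective.ne hij.ne)
  have hz0 : (σ z).val = 0 := by simp [hz]
  split_ifs with hi hj hj
  · have := hσ i j z hij hj
    rw [Fin.lt_def, Fin.lt_def] at this
    omega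
  · have := hmin i hi.ne
    omega
  · exact absurd (hij.trans hj) hi
  · have hj' := hmin j (by lia)
    by_cases h : i = z
    · subst h
      omega
    · have := hσ z i j (by lia) hij (by rw [Fin.lt_def, hz0]; exact hmin i h)
      exact_mod_cast this

/-- Indexing the occurrences of a pattern by their increasing triples of values. -/
theorem occ_eq_card {n : ℕ} {q : Fin 3 → ℕ} {ρ : Equiv.Perm (Fin 3)}
    (hq : ∀ j l, q j < q l ↔ ρ j < ρ l) (σ : Equiv.Perm (Fin n)) :
    occ n q σ = (univ.filter fun w : Fin 3 ↪o Fin n =>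
      ∀ j l, j < l → σ.symm (w (ρ j)) < σ.symm (w (ρ l))).card := by
  symm
  refine card_bij (fun w _ j => σ.symm (w (ρ j))) ?_ ?_ ?_
  · intro w hw
    simpa [hq] using hw
  · intro w _ w' _ h
    ext j
    simpa using congrArg Fin.val (congrArg σ (congrFun h (ρ.symm j)))
  · intro ι hι
    simp only [mem_filter, mem_univ, true_and, hq] at hι
    refine ⟨OrderEmbedding.ofStrictMono (fun j => σ (ι (ρ.symm j))) fun j l hjl =>
      (hι.2 _ _).1 (by simpa using hjl), ?_, ?_⟩
    · simp only [mem_filter, mem_univ, true_and]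
      intro j l hjl
      change σ.symm (σ (ι (ρ.symm (ρ j)))) < σ.symm (σ (ι (ρ.symm (ρ l))))
      simpa using hι.1 j l hjl
    · funext j
      change σ.symm (σ (ι (ρ.symm (ρ j)))) = ι j
      simp

theorem card_orderEmbedding_fin (k n : ℕ) :
    Fintype.card (Fin k ↪o Fin n) = n.choose k := by
  rw [← Nat.card_eq_fintype_card, Nat.card_congr Set.powersetCard.ofFinEmbEquiv,
    Set.powersetCard.card, Nat.card_eq_fintype_card, Fintype.card_fin]

theorem card_filter_mem_iff {α : Type*} [DecidableEq α] {U : Finset α} {x y : α}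
    (hx : x ∈ U) (hy : y ∈ U) (hxy : x ≠ y) (β γ : Bool) :
    (U.powerset.filter fun S => (x ∈ S ↔ β = true) ∧ (y ∈ S ↔ γ = true)).card =
      2 ^ (U.card - 2) := by
  have hcard : ({x, y} : Finset α).card = 2 := card_pair hxy
  set E := ({x, y} : Finset α).filter fun z => (z = x ∧ β = true) ∨ (z = y ∧ γ = true) with hE
  set F := ({x, y} : Finset α) \ E with hF
  have hEs : E ⊆ {x, y} := filter_subset _ _
  have hFU : F ⊆ U := by
    intro z hz
    have := (mem_sdiff.1 hz).1
    simp only [mem_insert, mem_singleton] at this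
    rcases this with rfl | rfl <;> assumption
  have hEU : E ⊆ U \ F := by
    intro z hz
    have := hEs hz
    simp only [mem_insert, mem_singleton] at this
    refine mem_sdiff.2 ⟨by rcases this with rfl | rfl <;> assumption, fun h => ?_⟩
    exact (mem_sdiff.1 h).2 hz
  have key : (U.powerset.filter fun S => (x ∈ S ↔ β = true) ∧ (y ∈ S ↔ γ = true)) =
      Icc E (U \ F) := by
    ext S
    simp only [mem_filter, mem_powerset, mem_Icc, subset_iff, mem_sdiff, hF, hE,
      mem_insert, mem_singleton]
    cases β <;> cases γ <;> grind
  rw [key, card_Icc_finset hEU, card_sdiff_of_subset hFU, hF, card_sdiff_of_subset hEs, hcard]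
  have := card_le_card hEs
  congr 1
  omega

/-- If the relative order of the keys of `w 0 < w 1 < w 2` prescribed by `ρ` amounts to
prescribing the sides of `w 1` and `w 2`, then the pattern occurs `n.choose 3 * 2 ^ (n - 3)`
times. -/
theorem fCnt_eq {n : ℕ} (hn : 3 ≤ n) {q : Fin 3 → ℕ} (ρ : Equiv.Perm (Fin 3)) (β γ : Bool)
    (hq : ∀ j l, q j < q l ↔ ρ j < ρ l)
    (hkey : ∀ (S : Finset (Fin n)) (w : Fin 3 ↪o Fin n),
      (∀ j l, j < l → sideKey S (w (ρ j)) < sideKey S (w (ρ l))) ↔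
        (w 1 ∈ S ↔ β = true) ∧ (w 2 ∈ S ↔ γ = true)) :
    fCnt n q [p132, p231] = n.choose 3 * 2 ^ (n - 3) := by
  obtain ⟨m, rfl⟩ : ∃ m, n = m + 1 := ⟨n - 1, by omega⟩
  have hsum : fCnt (m + 1) q [p132, p231] =
      ∑ S ∈ (univ.erase (0 : Fin (m + 1))).powerset, occ (m + 1) q (Tuple.sort (sideKey S)) := by
    refine sum_bij' (fun σ _ => leftValues σ) (fun S _ => Tuple.sort (sideKey S)) ?_ ?_ ?_ ?_ ?_
    · exact fun σ _ => mem_powerset.2 (leftValues_subset σ)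
    · exact fun S _ => sort_sideKey_mem_avoiders S
    · exact fun σ hσ => sort_sideKey_leftValues hσ
    · exact fun S hS => leftValues_sort_sideKey (mem_powerset.1 hS)
    · exact fun σ hσ => by rw [sort_sideKey_leftValues hσ]
  simp only [hsum, occ_eq_card hq, sort_symm_lt_iff, hkey]
  simp only [card_filter]
  rw [sum_comm]
  simp only [← card_filter]
  have hcount : ∀ w : Fin 3 ↪o Fin (m + 1),
      ((univ.erase (0 : Fin (m + 1))).powerset.filter fun S =>
        (w 1 ∈ S ↔ β = true) ∧ (w 2 ∈ S ↔ γ = true)).card = 2 ^ (m + 1 - 3) := by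
    intro w
    have h01 : w 0 < w 1 := w.strictMono (by decide)
    have h12 : w 1 < w 2 := w.strictMono (by decide)
    rw [card_filter_mem_iff (by simpa using (Fin.pos_iff_ne_zero.1 (by lia)))
      (by simpa using (Fin.pos_iff_ne_zero.1 (by lia))) h12.ne]
    simp
  simp only [hcount, sum_const, card_univ, card_orderEmbedding_fin, smul_eq_mul]

/-- Theorem `tc1`: in `S_n(132,231)` for `n ≥ 3`, the patterns 123, 213, 312 and 321
each occur `C(n,3)·2^{n−3}` times in total. -/
theorem stmt_6 (n : ℕ) (hn : 3 ≤ n) :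
    fCnt n p123 [p132, p231] = n.choose 3 * 2 ^ (n - 3) ∧
    fCnt n p213 [p132, p231] = n.choose 3 * 2 ^ (n - 3) ∧
    fCnt n p312 [p132, p231] = n.choose 3 * 2 ^ (n - 3) ∧
    fCnt n p321 [p132, p231] = n.choose 3 * 2 ^ (n - 3) := by
  have hw : ∀ w : Fin 3 ↪o Fin n, (w 0).val < (w 1).val ∧ (w 1).val < (w 2).val :=
    fun w => ⟨w.strictMono (by decide), w.strictMono (by decide)⟩
  have hall : ∀ f : Fin 3 → ℤ, (∀ j l, j < l → f j < f l) ↔ f 0 < f 1 ∧ f 1 < f 2 := by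
    intro f
    simp [Fin.forall_fin_succ]
    lia
  refine ⟨fCnt_eq hn 1 false false (by decide) fun S w => ?_,
    fCnt_eq hn (Equiv.swap 0 1) true false (by decide) fun S w => ?_,
    fCnt_eq hn (finRotate 3).symm false true (by decide) fun S w => ?_,
    fCnt_eq hn (Equiv.swap 0 2) true true (by decide) fun S w => ?_⟩
  · rw [hall fun j => sideKey S (w ((1 : Equiv.Perm (Fin 3)) j))]
    change sideKey S (w 0) < sideKey S (w 1) ∧ sideKey S (w 1) < sideKey S (w 2) ↔ _
    have := hw w
    unfold sideKey
    split_ifs <;> simp [*]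
    omega
  · rw [hall fun j => sideKey S (w (Equiv.swap 0 1 j))]
    change sideKey S (w 1) < sideKey S (w 0) ∧ sideKey S (w 0) < sideKey S (w 2) ↔ _
    have := hw w
    unfold sideKey
    split_ifs <;> simp [*] <;> omega
  · rw [hall fun j => sideKey S (w ((finRotate 3).symm j))]
    change sideKey S (w 2) < sideKey S (w 0) ∧ sideKey S (w 0) < sideKey S (w 1) ↔ _
    have := hw w
    unfold sideKey
    split_ifs <;> simp [*] <;> omega
  · rw [hall fun j => sideKey S (w (Equiv.swap 0 2 j))]
    change sideKey S (w 2) < sideKey S (w 1) ∧ sideKey S (w 1) < sideKey S (w 0) ↔ _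
    have := hw w
    unfold sideKey
    split_ifs <;> simp [*]
    omega
end

section
/- For every integer n ≥ 3, in the set S_n(132,321): f_{213}(S_n(132,321)) = f_{231}(S_n(132,321)) = f_{312}(S_n(132,321)) = binom(n+2, 5), and 120·f_{123}(S_n(132,321)) = n(7n⁴ − 40n³ + 85n² − 80n + 28) (i.e., f_{123}(S_n(132,321)) = n(7n⁴−40n³+85n²−80n+28)/120). -/
open Finset

/-- The map on `ℕ` exchanging the adjacent blocks `[0, i)` and `[i, i + j)`, each kept in
increasing order. -/
def blockSwap (i j x : ℕ) : ℕ :=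
  if x < i then x + j else if x < i + j then x - i else x

theorem blockSwap_lt {n i j x : ℕ} (h : i + j ≤ n) (hx : x < n) : blockSwap i j x < n := by
  unfold blockSwap; split_ifs <;> omega

theorem blockSwap_blockSwap (i j x : ℕ) : blockSwap j i (blockSwap i j x) = x := by
  unfold blockSwap; split_ifs <;> omega

/-- The permutation of `Fin n` induced by `blockSwap i j` when `i + j ≤ n`. -/
def blockPerm (n i j : ℕ) : Equiv.Perm (Fin n) :=
  if h : i + j ≤ n then
    { toFun := fun x => ⟨blockSwap i j x, blockSwap_lt h x.2⟩
      invFun := fun x => ⟨blockSwap j i x, blockSwap_lt (by omega) x.2⟩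
      left_inv := fun x => Fin.ext (blockSwap_blockSwap i j x)
      right_inv := fun x => Fin.ext (blockSwap_blockSwap j i x) }
  else 1

theorem blockPerm_apply {n i j : ℕ} (h : i + j ≤ n) (x : Fin n) :
    (blockPerm n i j x : ℕ) = blockSwap i j x := by
  simp [blockPerm, h]

/-- The predicate that `x, y, z` are in the same relative order as the values of `q`. -/
def SameOrder (q : Fin 3 → ℕ) (x y z : ℕ) : Prop :=
  ∀ j l : Fin 3, q j < q l ↔ ![x, y, z] j < ![x, y, z] l

instance (q : Fin 3 → ℕ) (x y z : ℕ) : Decidable (SameOrder q x y z) := by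
  unfold SameOrder; infer_instance

theorem sameOrder_p123 (x y z : ℕ) : SameOrder p123 x y z ↔ x < y ∧ y < z := by
  simp [SameOrder, Fin.forall_fin_succ, p123]; omega

theorem sameOrder_p132 (x y z : ℕ) : SameOrder p132 x y z ↔ x < z ∧ z < y := by
  simp [SameOrder, Fin.forall_fin_succ, p132]; omega

theorem sameOrder_p213 (x y z : ℕ) : SameOrder p213 x y z ↔ y < x ∧ x < z := by
  simp [SameOrder, Fin.forall_fin_succ, p213]; omega

theorem sameOrder_p231 (x y z : ℕ) : SameOrder p231 x y z ↔ z < x ∧ x < y := by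
  simp [SameOrder, Fin.forall_fin_succ, p231]; omega

theorem sameOrder_p312 (x y z : ℕ) : SameOrder p312 x y z ↔ y < z ∧ z < x := by
  simp [SameOrder, Fin.forall_fin_succ, p312]; omega

theorem sameOrder_p321 (x y z : ℕ) : SameOrder p321 x y z ↔ z < y ∧ y < x := by
  simp [SameOrder, Fin.forall_fin_succ, p321]; omega

/-- The triples `a < b < c` of natural numbers below `n`. -/
def triples (n : ℕ) : Finset (ℕ × ℕ × ℕ) :=
  (range n ×ˢ range n ×ˢ range n).filter fun t => t.1 < t.2.1 ∧ t.2.1 < t.2.2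

theorem mem_triples {n : ℕ} {t : ℕ × ℕ × ℕ} :
    t ∈ triples n ↔ t.1 < t.2.1 ∧ t.2.1 < t.2.2 ∧ t.2.2 < n := by
  simp only [triples, mem_filter, mem_product, mem_range]; omega

theorem occ_eq_card_triples {n : ℕ} (q : Fin 3 → ℕ) (σ : Equiv.Perm (Fin n)) (s : ℕ → ℕ)
    (hs : ∀ x : Fin n, (σ x : ℕ) = s x) :
    occ n q σ = #{t ∈ triples n | SameOrder q (s t.1) (s t.2.1) (s t.2.2)} := by
  unfold occ
  have key : ∀ ι : Fin 3 → Fin n, (∀ j l : Fin 3, q j < q l ↔ σ (ι j) < σ (ι l)) ↔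
      SameOrder q (s (ι 0)) (s (ι 1)) (s (ι 2)) := by
    intro ι
    simp [SameOrder, Fin.forall_fin_succ, ← hs]
  have mono : ∀ ι : Fin 3 → Fin n, (∀ j l : Fin 3, j < l → ι j < ι l) ↔
      (ι 0 : ℕ) < ι 1 ∧ (ι 1 : ℕ) < ι 2 := by
    intro ι
    simp [Fin.forall_fin_succ]
    omega
  refine Finset.card_bij (fun ι _ => ((ι 0 : ℕ), (ι 1 : ℕ), (ι 2 : ℕ))) ?_ ?_ ?_
  · intro ι hι
    simp only [mem_filter, mem_univ, true_and, key, mono, mem_triples] at hι ⊢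
    exact ⟨⟨hι.1.1, hι.1.2, (ι 2).2⟩, hι.2⟩
  · intro ι _ κ _ h
    simp only [Prod.mk.injEq] at h
    funext k
    fin_cases k
    · exact Fin.ext h.1
    · exact Fin.ext h.2.1
    · exact Fin.ext h.2.2
  · rintro ⟨a, b, c⟩ h
    simp only [mem_filter, mem_triples] at h
    refine ⟨![⟨a, by omega⟩, ⟨b, by omega⟩, ⟨c, by omega⟩], ?_, rfl⟩
    simp only [mem_filter, mem_univ, true_and, key, mono]
    exact ⟨⟨h.1.1, h.1.2.1⟩, h.2⟩

theorem card_sigma_range (n : ℕ) : #((range n).sigma fun b => range b) = n.choose 2 := by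
  rw [card_sigma]
  simp [Finset.sum_range_id, Nat.choose_two_right]

theorem card_triples (n : ℕ) : #(triples n) = n.choose 3 := by
  have h : #(triples n) =
      #((range n).sigma fun c => (range c).sigma fun b => range b) := by
    refine Finset.card_nbij' (fun t => ⟨t.2.2, t.2.1, t.1⟩) (fun t => (t.2.2, t.2.1, t.1))
      ?_ ?_ (fun _ _ => rfl) (fun _ _ => rfl)
    · rintro ⟨a, b, c⟩ h
      simp only [mem_coe, mem_triples, mem_sigma, mem_range] at h ⊢
      omega
    · rintro ⟨c, b, a⟩ h
      simp only [mem_coe, mem_triples, mem_sigma, mem_range] at h ⊢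
      omega
  rw [h, card_sigma]
  simp only [card_sigma_range]
  clear h
  induction n with
  | zero => rfl
  | succ n ih => rw [sum_range_succ, ih, Nat.choose_succ_succ' n 2, add_comm]

theorem sum_occ_eq_choose {n : ℕ} (σ : Equiv.Perm (Fin n)) :
    occ n p123 σ + occ n p132 σ + occ n p213 σ + occ n p231 σ + occ n p312 σ + occ n p321 σ =
      n.choose 3 := by
  obtain ⟨s, hs⟩ : ∃ s : ℕ → ℕ, ∀ x : Fin n, (σ x : ℕ) = s x :=
    ⟨fun x => if h : x < n then σ ⟨x, h⟩ else x, fun x => by simp⟩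
  have inj : ∀ x < n, ∀ y < n, s x = s y → x = y := by
    intro x hx y hy h
    rw [← hs ⟨x, hx⟩, ← hs ⟨y, hy⟩] at h
    simpa using σ.injective (Fin.ext h)
  simp only [occ_eq_card_triples _ σ s hs, card_filter]
  simp only [← sum_add_distrib, ← card_triples, card_eq_sum_ones]
  refine Finset.sum_congr rfl ?_
  rintro ⟨a, b, c⟩ h
  rw [mem_triples] at h
  dsimp only at h ⊢
  have hab : s a ≠ s b := fun e => by have := inj a (by omega) b (by omega) e; omega
  have hac : s a ≠ s c := fun e => by have := inj a (by omega) c (by omega) e; omega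
  have hbc : s b ≠ s c := fun e => by have := inj b (by omega) c (by omega) e; omega
  simp only [sameOrder_p123, sameOrder_p132, sameOrder_p213, sameOrder_p231, sameOrder_p312,
    sameOrder_p321]
  split_ifs <;> omega

theorem occ_eq_zero_iff {n : ℕ} (q : Fin 3 → ℕ) (σ : Equiv.Perm (Fin n)) (s : ℕ → ℕ)
    (hs : ∀ x : Fin n, (σ x : ℕ) = s x) :
    occ n q σ = 0 ↔ ∀ a b c, a < b → b < c → c < n → ¬ SameOrder q (s a) (s b) (s c) := by
  rw [occ_eq_card_triples q σ s hs, card_eq_zero, filter_eq_empty_iff]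
  constructor
  · intro h a b c hab hbc hc
    exact @h (a, b, c) (mem_triples.2 ⟨hab, hbc, hc⟩)
  · rintro h ⟨a, b, c⟩ ht
    rw [mem_triples] at ht
    exact h a b c ht.1 ht.2.1 ht.2.2

theorem occ_p132_blockPerm {n i j : ℕ} (h : i + j ≤ n) : occ n p132 (blockPerm n i j) = 0 := by
  rw [occ_eq_zero_iff _ _ _ (blockPerm_apply h)]
  intro a b c hab hbc hc
  rw [sameOrder_p132]
  unfold blockSwap; split_ifs <;> omega

theorem occ_p321_blockPerm {n i j : ℕ} (h : i + j ≤ n) : occ n p321 (blockPerm n i j) = 0 := by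
  rw [occ_eq_zero_iff _ _ _ (blockPerm_apply h)]
  intro a b c hab hbc hc
  rw [sameOrder_p321]
  unfold blockSwap; split_ifs <;> omega

theorem occ_p213_blockPerm {n i j : ℕ} (h : i + j ≤ n) :
    occ n p213 (blockPerm n i j) = i * j * (n - i - j) := by
  rw [occ_eq_card_triples _ _ _ (blockPerm_apply h)]
  have : i * j * (n - i - j) = #((range i ×ˢ range j) ×ˢ range (n - i - j)) := by simp
  rw [this]
  refine Finset.card_nbij' (fun t => ((t.1, t.2.1 - i), t.2.2 - i - j))
    (fun t => (t.1.1, t.1.2 + i, t.2 + i + j)) ?_ ?_ ?_ ?_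
  · rintro ⟨a, b, c⟩ ht
    simp only [mem_coe, mem_filter, mem_triples, sameOrder_p213, mem_product, mem_range,
      blockSwap] at ht ⊢
    split_ifs at ht <;> omega
  · rintro ⟨⟨a, b⟩, c⟩ ht
    simp only [mem_coe, mem_filter, mem_triples, sameOrder_p213, mem_product, mem_range,
      blockSwap] at ht ⊢
    split_ifs <;> omega
  · rintro ⟨a, b, c⟩ ht
    simp only [mem_coe, mem_filter, mem_triples, sameOrder_p213, blockSwap] at ht
    simp only [Prod.mk.injEq, true_and]
    split_ifs at ht <;> omega
  · rintro ⟨⟨a, b⟩, c⟩ ht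
    simp only [Prod.mk.injEq, true_and]
    omega

theorem occ_p231_blockPerm {n i j : ℕ} (h : i + j ≤ n) :
    occ n p231 (blockPerm n i j) = i.choose 2 * j := by
  rw [occ_eq_card_triples _ _ _ (blockPerm_apply h)]
  have : i.choose 2 * j = #(((range i).sigma fun b => range b) ×ˢ range j) := by
    rw [card_product, card_sigma_range, card_range]
  rw [this]
  refine Finset.card_nbij' (fun t => (⟨t.2.1, t.1⟩, t.2.2 - i))
    (fun t => (t.1.2, t.1.1, t.2 + i)) ?_ ?_ ?_ ?_
  · rintro ⟨a, b, c⟩ ht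
    simp only [mem_coe, mem_filter, mem_triples, sameOrder_p231, mem_product, mem_range,
      mem_sigma, blockSwap] at ht ⊢
    split_ifs at ht <;> omega
  · rintro ⟨⟨a, b⟩, c⟩ ht
    simp only [mem_coe, mem_filter, mem_triples, sameOrder_p231, mem_product, mem_range,
      mem_sigma, blockSwap] at ht ⊢
    split_ifs <;> omega
  · rintro ⟨a, b, c⟩ ht
    simp only [mem_coe, mem_filter, mem_triples, sameOrder_p231, blockSwap] at ht
    simp only [Prod.mk.injEq, true_and]
    split_ifs at ht <;> omega
  · rintro ⟨⟨a, b⟩, c⟩ ht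
    simp

theorem occ_p312_blockPerm {n i j : ℕ} (h : i + j ≤ n) :
    occ n p312 (blockPerm n i j) = i * j.choose 2 := by
  rw [occ_eq_card_triples _ _ _ (blockPerm_apply h)]
  have : i * j.choose 2 = #(range i ×ˢ ((range j).sigma fun b => range b)) := by
    rw [card_product, card_sigma_range, card_range]
  rw [this]
  refine Finset.card_nbij' (fun t => (t.1, ⟨t.2.2 - i, t.2.1 - i⟩))
    (fun t => (t.1, t.2.2 + i, t.2.1 + i)) ?_ ?_ ?_ ?_
  · rintro ⟨a, b, c⟩ ht
    simp only [mem_coe, mem_filter, mem_triples, sameOrder_p312, mem_product, mem_range,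
      mem_sigma, blockSwap] at ht ⊢
    split_ifs at ht <;> omega
  · rintro ⟨a, ⟨b, c⟩⟩ ht
    simp only [mem_coe, mem_filter, mem_triples, sameOrder_p312, mem_product, mem_range,
      mem_sigma, blockSwap] at ht ⊢
    split_ifs <;> omega
  · rintro ⟨a, b, c⟩ ht
    simp only [mem_coe, mem_filter, mem_triples, sameOrder_p312, blockSwap] at ht
    simp only [Prod.mk.injEq, true_and]
    split_ifs at ht <;> omega
  · rintro ⟨a, ⟨b, c⟩⟩ ht
    simp

/-- The core of the classification of permutations avoiding 132 and 321: such a permutation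
`s` of `[0, n)`, with inverse `p`, exchanges two adjacent blocks determined by `p 0`, `s 0`. -/
theorem eq_blockSwap_of_avoids {n : ℕ} (hn : 0 < n) {s p : ℕ → ℕ}
    (hs : ∀ x < n, s x < n) (hp : ∀ x < n, p x < n)
    (hps : ∀ x < n, p (s x) = x) (hsp : ∀ x < n, s (p x) = x)
    (h132 : ∀ a b c, a < b → b < c → c < n → ¬ (s a < s c ∧ s c < s b))
    (h321 : ∀ a b c, a < b → b < c → c < n → ¬ (s c < s b ∧ s b < s a)) :
    p 0 + s 0 ≤ n ∧ ∀ x < n, s x = blockSwap (p 0) (s 0) x := by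
  set i := p 0 with hi
  set j := s 0 with hj
  have hin : i < n := hp 0 hn
  have hsi : s i = 0 := hsp 0 hn
  have inj : ∀ x < n, ∀ y < n, s x = s y → x = y := fun x hx y hy h => by
    rw [← hps x hx, ← hps y hy, h]
  have low : ∀ x < i, j ≤ s x := by
    intro x hx
    rcases Nat.eq_zero_or_pos x with rfl | h0
    · exact le_rfl
    by_contra hlt
    have := h321 0 x i h0 hx hin
    have : s x ≠ 0 := fun e => by have := inj x (by omega) i hin (by omega); omega
    omega
  have mono₁ : ∀ x y, x < y → y < i → s x < s y := by
    intro x y hxy hy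
    have h1 := low x (by omega)
    have h2 := low y hy
    have h3 : s x ≠ s y := fun e => by have := inj x (by omega) y (by omega) e; omega
    rcases Nat.eq_zero_or_pos x with rfl | h0
    · omega
    have h4 : s 0 ≠ s y := fun e => by have := inj 0 (by omega) y (by omega) e; omega
    have := h132 0 x y h0 hxy (by omega)
    omega
  have mono₂ : ∀ x y, i ≤ x → x < y → y < n → s x < s y := by
    intro x y hx hxy hy
    have h3 : s x ≠ s y := fun e => by have := inj x (by omega) y (by omega) e; omega
    have h4 : s i ≠ s y := fun e => by have := inj i (by omega) y (by omega) e; omega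
    rcases Nat.eq_or_lt_of_le hx with rfl | h0
    · omega
    have := h132 i x y h0 hxy (by omega)
    omega
  have first : ∀ x, x < i → s x = x + j := by
    intro x
    induction x using Nat.strong_induction_on with
    | _ x ih =>
    intro hx
    rcases Nat.eq_zero_or_pos x with rfl | h0
    · omega
    have h1 := ih (x - 1) (by omega) (by omega)
    have h2 := mono₁ (x - 1) x (by omega) hx
    have h3 := hs x (by omega)
    by_contra hne
    have hv : s (p (x + j)) = x + j := hsp _ (by omega)
    have hy := hp (x + j) (by omega)
    set y := p (x + j)
    rcases lt_trichotomy y x with hyx | hyx | hyx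
    · have := ih y hyx (by omega); omega
    · rw [hyx] at hv; omega
    · have := h132 0 x y h0 hyx hy
      omega
  have hij : i + j ≤ n := by
    rcases Nat.eq_zero_or_pos i with h0 | h0
    · have : j = 0 := by rw [h0] at hsi; exact hsi
      omega
    · have := first (i - 1) (by omega)
      have := hs (i - 1) (by omega)
      omega
  refine ⟨hij, ?_⟩
  intro x
  induction x using Nat.strong_induction_on with
  | _ x ih =>
  intro hx
  by_cases hxi : x < i
  · rw [first x hxi, blockSwap, if_pos hxi]
  have hinv := blockSwap_blockSwap i j x
  have hvn : blockSwap i j x < n := blockSwap_lt hij hx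
  apply le_antisymm
  · have hv := hsp _ hvn
    have hyn := hp _ hvn
    set y := p (blockSwap i j x)
    rcases lt_trichotomy y x with hyx | hyx | hyx
    · have h1 := ih y hyx hyn
      have h2 := blockSwap_blockSwap i j y
      rw [← h1, hv, hinv] at h2
      omega
    · rw [hyx] at hv; omega
    · have := mono₂ x y (by omega) hyx hyn; omega
  · by_contra hlt
    have h1 := blockSwap_blockSwap j i (s x)
    have h2 : blockSwap j i (s x) < x := by
      revert hlt
      unfold blockSwap
      split_ifs <;> omega
    have h3 := ih _ h2 (by omega)
    rw [h1] at h3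
    have := inj _ (by omega) x hx h3
    omega

/-- The pairs of positive block lengths with sum at most `n`. -/
def blockPairs (n : ℕ) : Finset (ℕ × ℕ) :=
  (range (n + 1) ×ˢ range (n + 1)).filter fun t => 1 ≤ t.1 ∧ 1 ≤ t.2 ∧ t.1 + t.2 ≤ n

theorem mem_blockPairs {n : ℕ} {t : ℕ × ℕ} :
    t ∈ blockPairs n ↔ 1 ≤ t.1 ∧ 1 ≤ t.2 ∧ t.1 + t.2 ≤ n := by
  simp only [blockPairs, mem_filter, mem_product, mem_range]; omega

theorem card_blockPairs (n : ℕ) : #(blockPairs n) = n.choose 2 := by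
  rw [← card_sigma_range]
  refine Finset.card_nbij' (fun t => ⟨t.1 + t.2 - 1, t.1 - 1⟩)
    (fun t => (t.2 + 1, t.1 - t.2)) ?_ ?_ ?_ ?_
  · rintro ⟨i, j⟩ h
    simp only [mem_coe, mem_blockPairs, mem_sigma, mem_range] at h ⊢
    omega
  · rintro ⟨m, a⟩ h
    simp only [mem_coe, mem_blockPairs, mem_sigma, mem_range] at h ⊢
    omega
  · rintro ⟨i, j⟩ h
    simp only [mem_coe, mem_blockPairs, Prod.mk.injEq] at h ⊢
    omega
  · rintro ⟨m, a⟩ h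
    simp only [mem_coe, mem_sigma, mem_range] at h
    simp only [Sigma.mk.injEq, heq_eq_eq]
    omega

theorem avoiders_eq_image {n : ℕ} (hn : 0 < n) :
    avoiders n [p132, p321] =
      (insert (0, 0) (blockPairs n)).image fun t => blockPerm n t.1 t.2 := by
  ext σ
  simp only [avoiders, mem_filter, mem_univ, true_and, List.mem_cons, List.not_mem_nil, or_false,
    forall_eq_or_imp, forall_eq, mem_image, mem_insert]
  constructor
  · rintro ⟨h1, h2⟩
    rw [occ_eq_zero_iff _ _ (fun x => if h : x < n then (σ ⟨x, h⟩ : ℕ) else x)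
      (fun x => by simp)] at h1 h2
    simp only [sameOrder_p132] at h1
    simp only [sameOrder_p321] at h2
    obtain ⟨h3, h4⟩ := eq_blockSwap_of_avoids hn
      (s := fun x => if h : x < n then (σ ⟨x, h⟩ : ℕ) else x)
      (p := fun x => if h : x < n then (σ.symm ⟨x, h⟩ : ℕ) else x)
      (fun x hx => by simp [hx]) (fun x hx => by simp [hx])
      (fun x hx => by simp [hx]) (fun x hx => by simp [hx]) h1 h2
    simp only [hn, dite_true] at h3 h4
    have heq : blockPerm n (σ.symm ⟨0, hn⟩) (σ ⟨0, hn⟩) = σ := by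
      ext x
      rw [blockPerm_apply h3, ← h4 x x.2]
      simp
    refine ⟨(σ.symm ⟨0, hn⟩, σ ⟨0, hn⟩), ?_, heq⟩
    have e : (σ.symm ⟨0, hn⟩ : ℕ) = 0 ↔ (σ ⟨0, hn⟩ : ℕ) = 0 := by
      have h5 : (σ.symm ⟨0, hn⟩ : ℕ) = 0 ↔ σ.symm ⟨0, hn⟩ = ⟨0, hn⟩ := by simp [Fin.ext_iff]
      have h6 : (σ ⟨0, hn⟩ : ℕ) = 0 ↔ σ ⟨0, hn⟩ = ⟨0, hn⟩ := by simp [Fin.ext_iff]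
      rw [h5, h6, Equiv.symm_apply_eq, eq_comm]
    rw [mem_blockPairs, Prod.mk.injEq]
    dsimp only
    omega
  · rintro ⟨⟨i, j⟩, h, rfl⟩
    rw [mem_blockPairs, Prod.mk.injEq] at h
    exact ⟨occ_p132_blockPerm (by omega), occ_p321_blockPerm (by omega)⟩

theorem injOn_blockPerm {n : ℕ} (hn : 0 < n) :
    Set.InjOn (fun t : ℕ × ℕ => blockPerm n t.1 t.2) (insert (0, 0) (blockPairs n) : Finset _) := by
  have bounds : ∀ t ∈ insert (0, 0) (blockPairs n), t.1 + t.2 ≤ n ∧ t.1 < n ∧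
      blockSwap t.1 t.2 0 = t.2 ∧ blockSwap t.1 t.2 t.1 = 0 := by
    rintro ⟨i, j⟩ h
    simp only [mem_insert, mem_blockPairs, Prod.mk.injEq] at h
    refine ⟨by omega, by omega, ?_, ?_⟩
    · unfold blockSwap; split_ifs <;> omega
    · unfold blockSwap; split_ifs <;> omega
  rintro ⟨i, j⟩ h ⟨k, l⟩ h' heq
  obtain ⟨hij, -, h0, hi⟩ := bounds _ h
  obtain ⟨hkl, hk, h0', hk0⟩ := bounds _ h'
  dsimp only at hij h0 hi hkl hk h0' hk0 heq
  have key : ∀ x < n, blockSwap i j x = blockSwap k l x := fun x hx => by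
    rw [← blockPerm_apply hij ⟨x, hx⟩, heq, blockPerm_apply hkl]
  have hjl : j = l := by rw [← h0, ← h0', key 0 hn]
  have hik : i = k := by
    rw [← blockSwap_blockSwap i j i, hi, ← hk0, ← key k hk, blockSwap_blockSwap]
  rw [hjl, hik]

theorem fCnt_eq_sum {n : ℕ} (hn : 0 < n) (q : Fin 3 → ℕ) :
    fCnt n q [p132, p321] =
      occ n q (blockPerm n 0 0) + ∑ t ∈ blockPairs n, occ n q (blockPerm n t.1 t.2) := by
  rw [fCnt, avoiders_eq_image hn, sum_image (injOn_blockPerm hn),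
    sum_insert (by simp [mem_blockPairs])]

theorem sum_antidiagonal_choose_mul_choose (n p q : ℕ) :
    ∑ t ∈ antidiagonal n, t.1.choose p * t.2.choose q = (n + 1).choose (p + q + 1) := by
  induction n generalizing p with
  | zero => cases p <;> cases q <;> simp [Nat.choose_eq_zero_of_lt]
  | succ n ih =>
    rw [Finset.Nat.sum_antidiagonal_succ]
    cases p with
    | zero =>
      have h := ih 0
      simp only [Nat.choose_zero_right, one_mul, zero_add] at h ⊢
      rw [h, Nat.choose_succ_succ' (n + 1) q]
    | succ p =>
      simp only [Nat.choose_zero_succ, zero_mul, zero_add, Nat.choose_succ_succ' _ p, add_mul,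
        sum_add_distrib, ih]
      rw [show p + 1 + q + 1 = (p + q + 1) + 1 by ring, Nat.choose_succ_succ' (n + 1)]

theorem sum_antidiagonal_choose_mul_choose_succ (n p q : ℕ) :
    ∑ t ∈ antidiagonal n, t.1.choose p * (t.2 + 1).choose (q + 1) =
      (n + 2).choose (p + q + 2) := by
  have h := sum_antidiagonal_choose_mul_choose (n + 1) p (q + 1)
  rw [Finset.Nat.sum_antidiagonal_succ'] at h
  simpa [add_assoc] using h

theorem sum_blockPairs_choose (n p q r : ℕ) :
    ∑ t ∈ blockPairs n, t.1.choose (p + 1) * t.2.choose (q + 1) * (n - t.1 - t.2).choose r =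
      (n + 2).choose (p + q + r + 4) := by
  have h : ∑ t ∈ blockPairs n,
        t.1.choose (p + 1) * t.2.choose (q + 1) * (n - t.1 - t.2).choose r =
      ∑ u ∈ (antidiagonal n).sigma fun u => antidiagonal u.2,
        u.1.1.choose (p + 1) * (u.2.1.choose (q + 1) * u.2.2.choose r) := by
    refine Finset.sum_bij_ne_zero
      (fun t _ _ => ⟨(t.1, n - t.1), (t.2, n - t.1 - t.2)⟩) ?_ ?_ ?_ ?_
    · rintro ⟨i, j⟩ h _
      simp only [mem_blockPairs, mem_sigma, HasAntidiagonal.mem_antidiagonal] at h ⊢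
      omega
    · rintro ⟨i, j⟩ _ _ ⟨k, l⟩ _ _ heq
      simp only [Sigma.mk.injEq, Prod.mk.injEq, heq_eq_eq] at heq ⊢
      exact ⟨heq.1.1, heq.2.1⟩
    · rintro ⟨⟨i, b⟩, ⟨j, k⟩⟩ h hne
      simp only [mem_sigma, HasAntidiagonal.mem_antidiagonal] at h
      obtain ⟨h1, h2⟩ := h
      have hi : i ≠ 0 := by rintro rfl; simp at hne
      have hj : j ≠ 0 := by rintro rfl; simp at hne
      have hb : n - i = b := by omega
      have hk : b - j = k := by omega
      refine ⟨(i, j), ?_, ?_, ?_⟩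
      · rw [mem_blockPairs]; dsimp only; omega
      · simpa only [hb, hk, mul_assoc] using hne
      · simp only [hb, hk]
    · rintro ⟨i, j⟩ _ _
      simp only [mul_assoc]
  rw [h, sum_sigma]
  simp only [← mul_sum, sum_antidiagonal_choose_mul_choose]
  rw [show p + q + r + 4 = (p + 1) + (q + 1 + r) + 2 by ring]
  exact sum_antidiagonal_choose_mul_choose_succ n (p + 1) (q + 1 + r)

theorem fCnt_p213 {n : ℕ} (hn : 0 < n) : fCnt n p213 [p132, p321] = (n + 2).choose 5 := by
  rw [fCnt_eq_sum hn, occ_p213_blockPerm (by omega), ← sum_blockPairs_choose n 0 0 1]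
  simp only [zero_mul, zero_add, Nat.choose_one_right]
  refine sum_congr rfl fun t ht => occ_p213_blockPerm (mem_blockPairs.1 ht).2.2

theorem fCnt_p231 {n : ℕ} (hn : 0 < n) : fCnt n p231 [p132, p321] = (n + 2).choose 5 := by
  rw [fCnt_eq_sum hn, occ_p231_blockPerm (by omega), ← sum_blockPairs_choose n 1 0 0]
  simp only [mul_zero, zero_add, Nat.choose_one_right, Nat.choose_zero_right, mul_one]
  refine sum_congr rfl fun t ht => occ_p231_blockPerm (mem_blockPairs.1 ht).2.2

theorem fCnt_p312 {n : ℕ} (hn : 0 < n) : fCnt n p312 [p132, p321] = (n + 2).choose 5 := by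
  rw [fCnt_eq_sum hn, occ_p312_blockPerm (by omega), ← sum_blockPairs_choose n 0 1 0]
  simp only [zero_mul, zero_add, Nat.choose_one_right, Nat.choose_zero_right, mul_one]
  refine sum_congr rfl fun t ht => occ_p312_blockPerm (mem_blockPairs.1 ht).2.2

theorem card_avoiders {n : ℕ} (hn : 0 < n) : #(avoiders n [p132, p321]) = n.choose 2 + 1 := by
  rw [avoiders_eq_image hn, card_image_of_injOn (injOn_blockPerm hn),
    card_insert_of_notMem (by simp [mem_blockPairs]), card_blockPairs]

theorem sum_fCnt {n : ℕ} (hn : 0 < n) :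
    fCnt n p123 [p132, p321] + fCnt n p213 [p132, p321] + fCnt n p231 [p132, p321] +
      fCnt n p312 [p132, p321] = (n.choose 2 + 1) * n.choose 3 := by
  rw [← card_avoiders hn]
  simp only [fCnt, ← sum_add_distrib]
  rw [← smul_eq_mul, ← sum_const]
  refine sum_congr rfl fun σ hσ => ?_
  simp only [avoiders, mem_filter, mem_univ, true_and, List.mem_cons, List.not_mem_nil, or_false,
    forall_eq_or_imp, forall_eq] at hσ
  have := sum_occ_eq_choose σ
  omega

/-- Theorem `te1`: in `S_n(132,321)` for `n ≥ 3`,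
`f_{213} = f_{231} = f_{312} = C(n+2, 5)` and
`f_{123} = n(7n⁴ − 40n³ + 85n² − 80n + 28)/120`. -/
theorem stmt_10 (n : ℕ) (hn : 3 ≤ n) :
    fCnt n p213 [p132, p321] = (n + 2).choose 5 ∧
    fCnt n p231 [p132, p321] = (n + 2).choose 5 ∧
    fCnt n p312 [p132, p321] = (n + 2).choose 5 ∧
    120 * (fCnt n p123 [p132, p321] : ℤ) =
      (n : ℤ) * (7 * (n : ℤ) ^ 4 - 40 * (n : ℤ) ^ 3 + 85 * (n : ℤ) ^ 2 - 80 * n + 28) := by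
  have h0 : 0 < n := by omega
  refine ⟨fCnt_p213 h0, fCnt_p231 h0, fCnt_p312 h0, ?_⟩
  have h := sum_fCnt h0
  rw [fCnt_p213 h0, fCnt_p231 h0, fCnt_p312 h0] at h
  obtain ⟨m, rfl⟩ : ∃ m, n = m + 3 := ⟨n - 3, by omega⟩
  have h2 := Nat.descFactorial_eq_factorial_mul_choose (m + 3) 2
  have h3 := Nat.descFactorial_eq_factorial_mul_choose (m + 3) 3
  have h5 := Nat.descFactorial_eq_factorial_mul_choose (m + 3 + 2) 5
  simp [Nat.descFactorial, Nat.factorial] at h2 h3 h5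
  zify at h h2 h3 h5
  push_cast
  generalize ((m + 3).choose 2 : ℤ) = x at *
  generalize ((m + 3).choose 3 : ℤ) = y at *
  generalize ((m + 3 + 2).choose 5 : ℤ) = z at *
  linear_combination 120 * h + 3 * h5 - 20 * (x + 1) * h3 - 10 * (m + 1) * (m + 2) * (m + 3) * h2
end
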